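/- Let A be a unital C*-algebra and let T(A) denote its tracial state space, equipped with the weak-* topology. Assume that the set of extreme points of T(A) is countable. Then for every a ∈ A with 0 ≤ a ≤ 1 and every ε > 0 there exists b ∈ Her(a) with 0 ≤ b and ‖a − b‖ < ε such that the rank function τ ↦ d_τ(b) is a continuous real-valued function on T(A). -/

import Mathlib

open scoped ComplexOrder

/-- The cut-off function `f_ε : ℝ → ℝ`: it is `0` on `(-∞, ε/2]`, `1` on `[ε, ∞)`,
and linear on `[ε/2, ε]` (for `ε > 0`). -/
noncomputable def fcut (ε : ℝ) : ℝ → ℝ := fun t => min 1 (max 0 ((t - ε / 2) / (ε / 2)))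

variable {A : Type*} [CStarAlgebra A] [PartialOrder A] [StarOrderedRing A]

/-- The hereditary C*-subalgebra generated by `a`, as a subset of `A`:
the norm closure of `{a x a : x ∈ A}`. -/
def herSet (a : A) : Set A := closure {y : A | ∃ x : A, y = a * x * a}

/-- The tracial state space `T(A)` of a unital C*-algebra, viewed inside the weak-* dual:
the continuous linear functionals `τ` with `τ 1 = 1`, `τ(x*x) ≥ 0` and `τ(xy) = τ(yx)`. -/
def tracialStates (A : Type*) [CStarAlgebra A] : Set (WeakDual ℂ A) :=
  {τ | τ 1 = 1 ∧ (∀ x : A, 0 ≤ τ (star x * x)) ∧ ∀ x y : A, τ (x * y) = τ (y * x)}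

/-- `d_τ(a) = sup_{ε > 0} τ(f_ε(a))`, the rank of `a` at the tracial state `τ`. -/
noncomputable def dtauW (τ : WeakDual ℂ A) (a : A) : ℝ :=
  sSup {r : ℝ | ∃ ε : ℝ, 0 < ε ∧ r = (τ (cfc (fcut ε) a)).re}

open Filter Topology

set_option linter.unusedSectionVars false

/-- A decreasing sequence of nonnegative continuous linear functionals on a compact set which
tends to `0` at every extreme point tends to `0` everywhere. -/
theorem tendsto_zero_of_tendsto_zero_extremePoints {E : Type*} [AddCommGroup E] [Module ℝ E]
    [TopologicalSpace E] [T2Space E] [IsTopologicalAddGroup E] [ContinuousSMul ℝ E]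
    [LocallyConvexSpace ℝ E] {K : Set E} (hK : IsCompact K) (p : ℕ → E →L[ℝ] ℝ)
    (hanti : ∀ x ∈ K, Antitone fun n => p n x) (hnonneg : ∀ x ∈ K, ∀ n, 0 ≤ p n x)
    (hext : ∀ x ∈ K.extremePoints ℝ, Tendsto (fun n => p n x) atTop (𝓝 0)) :
    ∀ x ∈ K, Tendsto (fun n => p n x) atTop (𝓝 0) := by
  have hbdd : ∀ x ∈ K, BddBelow (Set.range fun n => p n x) := fun x hx =>
    ⟨0, by rintro _ ⟨n, rfl⟩; exact hnonneg x hx n⟩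
  have hlim : ∀ x ∈ K, Tendsto (fun n => p n x) atTop (𝓝 (⨅ n, p n x)) := fun x hx =>
    tendsto_atTop_ciInf (hanti x hx) (hbdd x hx)
  rcases K.eq_empty_or_nonempty with rfl | hne
  · simp
  have husc : UpperSemicontinuousOn (fun x => ⨅ n, p n x) K :=
    upperSemicontinuousOn_ciInf hbdd fun n => (p n).continuous.continuousOn.upperSemicontinuousOn
  obtain ⟨x₀, hx₀, hmax⟩ := husc.exists_isMaxOn hne hK
  set M := ⨅ n, p n x₀ with hM
  have hle : ∀ x ∈ K, ⨅ n, p n x ≤ M := fun x hx => hmax hx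
  have hS : IsCompact (K ∩ {x | ∀ n, M ≤ p n x}) := by
    refine hK.inter_right ?_
    simp only [Set.ofPred_forall]
    exact isClosed_iInter fun n => isClosed_le continuous_const (p n).continuous
  have hSe : IsExtreme ℝ K (K ∩ {x | ∀ n, M ≤ p n x}) := by
    refine ⟨Set.inter_subset_left, fun x hx y hy z hz hzxy => ⟨hx, ?_⟩⟩
    obtain ⟨s, t, hs, ht, hst, rfl⟩ := hzxy
    have hcomb : M ≤ s * (⨅ n, p n x) + t * (⨅ n, p n y) := by
      refine ge_of_tendsto' (((hlim x hx).const_mul s).add ((hlim y hy).const_mul t)) fun n => ?_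
      simpa using hz.2 n
    have hx' : M ≤ ⨅ n, p n x := by
      have := hle y hy
      have h1 : t * (⨅ n, p n y) ≤ t * M := by gcongr
      have h2 : s * M ≤ s * ⨅ n, p n x := by
        have : M = s * M + t * M := by rw [← add_mul, hst, one_mul]
        linarith
      exact le_of_mul_le_mul_left h2 hs
    exact fun n => hx'.trans (ciInf_le (hbdd x hx) n)
  obtain ⟨y, hy⟩ := hS.extremePoints_nonempty
    ⟨x₀, hx₀, fun n => ciInf_le (hbdd x₀ hx₀) n⟩
  have hM0 : M ≤ 0 := ge_of_tendsto' (hext y (hSe.extremePoints_subset_extremePoints hy)) hy.1.2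
  intro x hx
  have h0 : ⨅ n, p n x = 0 :=
    le_antisymm ((hle x hx).trans hM0) (le_ciInf (hnonneg x hx))
  exact h0 ▸ hlim x hx

theorem continuous_fcut (ε : ℝ) : Continuous (fcut ε) := by
  unfold fcut
  fun_prop

theorem fcut_mono {ε : ℝ} (hε : 0 < ε) : Monotone (fcut ε) := by
  intro s t h
  unfold fcut
  gcongr

theorem fcut_nonneg (ε t : ℝ) : 0 ≤ fcut ε t := by
  simp [fcut]

theorem fcut_le_one (ε t : ℝ) : fcut ε t ≤ 1 := by
  simp [fcut]

theorem fcut_of_nonpos {ε t : ℝ} (hε : 0 < ε) (ht : t ≤ 0) : fcut ε t = 0 := by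
  have : (t - ε / 2) / (ε / 2) ≤ 0 := div_nonpos_of_nonpos_of_nonneg (by linarith) (by linarith)
  simp [fcut, max_eq_left this]

theorem fcut_of_ge {ε t : ℝ} (hε : 0 < ε) (ht : ε ≤ t) : fcut ε t = 1 := by
  have : 1 ≤ (t - ε / 2) / (ε / 2) := by rw [one_le_div (by linarith)]; linarith
  simp [fcut, this]

theorem fcut_anti {ε ε' : ℝ} (hε : 0 < ε) (h : ε ≤ ε') (t : ℝ) : fcut ε' t ≤ fcut ε t := by
  rcases le_total t 0 with ht | ht
  · rw [fcut_of_nonpos hε ht, fcut_of_nonpos (hε.trans_le h) ht]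
  · have h1 : ∀ e : ℝ, 0 < e → (t - e / 2) / (e / 2) = 2 * t / e - 1 := fun e he => by
      field_simp
    unfold fcut
    rw [h1 _ hε, h1 _ (hε.trans_le h)]
    gcongr

theorem apply_nonneg_of_mem_tracialStates {τ : WeakDual ℂ A} (hτ : τ ∈ tracialStates A) {x : A}
    (hx : 0 ≤ x) : 0 ≤ τ x := by
  obtain ⟨y, rfl⟩ := CStarAlgebra.nonneg_iff_eq_star_mul_self.mp hx
  exact hτ.2.1 y

theorem re_apply_mono_of_mem_tracialStates {τ : WeakDual ℂ A} (hτ : τ ∈ tracialStates A)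
    {x y : A} (h : x ≤ y) : (τ x).re ≤ (τ y).re := by
  have := apply_nonneg_of_mem_tracialStates hτ (sub_nonneg.2 h)
  rw [map_sub, sub_nonneg] at this
  exact (Complex.le_def.1 this).1

theorem norm_apply_le_of_isSelfAdjoint {τ : WeakDual ℂ A} (hτ : τ ∈ tracialStates A) {x : A}
    (hx : IsSelfAdjoint x) : ‖τ x‖ ≤ ‖x‖ := by
  have hone : τ (algebraMap ℝ A ‖x‖) = (‖x‖ : ℂ) := by
    rw [IsScalarTower.algebraMap_apply ℝ ℂ A, Algebra.algebraMap_eq_smul_one, map_smul, hτ.1]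
    simp
  have h1 := apply_nonneg_of_mem_tracialStates hτ (sub_nonneg.2 hx.le_algebraMap_norm_self)
  have h2 := apply_nonneg_of_mem_tracialStates hτ
    (sub_nonneg.2 hx.neg_algebraMap_norm_le_self)
  rw [map_sub, hone, sub_nonneg, Complex.le_def] at h1
  rw [map_sub, map_neg, hone, sub_nonneg, Complex.le_def] at h2
  have him : (τ x).im = 0 := by simpa using h1.2
  rw [← Complex.re_add_im (τ x), him]
  simp only [Complex.ofReal_zero, zero_mul, add_zero, Complex.norm_real, Real.norm_eq_abs]
  exact abs_le.2 ⟨by simpa using h2.1, by simpa using h1.1⟩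

theorem isClosed_tracialStates : IsClosed (tracialStates A) := by
  have he (x : A) : Continuous fun τ : WeakDual ℂ A => τ x := WeakDual.eval_continuous x
  simp only [tracialStates, Set.ofPred_and, Set.ofPred_forall]
  refine (isClosed_eq (he 1) continuous_const).inter (.inter ?_ ?_)
  · exact isClosed_iInter fun x => isClosed_le continuous_const (he _)
  · exact isClosed_iInter fun x => isClosed_iInter fun y => isClosed_eq (he _) (he _)

theorem isCompact_tracialStates : IsCompact (tracialStates A) := by
  refine (WeakDual.isCompact_closedBall (𝕜 := ℂ) (E := A) 0 2).of_isClosed_subset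
    isClosed_tracialStates fun τ hτ => ?_
  rw [Set.mem_preimage, mem_closedBall_zero_iff]
  refine ContinuousLinearMap.opNorm_le_bound _ zero_le_two fun x => ?_
  change ‖τ x‖ ≤ 2 * ‖x‖
  have h1 := norm_apply_le_of_isSelfAdjoint hτ (realPart x).2
  have h2 := norm_apply_le_of_isSelfAdjoint hτ (imaginaryPart x).2
  have h3 := realPart.norm_le x
  have h4 := imaginaryPart.norm_le x
  rw [AddSubgroup.coe_norm] at h3 h4
  calc ‖τ x‖ = ‖τ (realPart x : A) + Complex.I * τ (imaginaryPart x : A)‖ := by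
        conv_lhs => rw [← realPart_add_I_smul_imaginaryPart x]
        rw [map_add, map_smul, smul_eq_mul]
    _ ≤ ‖τ (realPart x : A)‖ + ‖τ (imaginaryPart x : A)‖ := by
        refine (norm_add_le _ _).trans ?_
        simp
    _ ≤ 2 * ‖x‖ := by linarith

/-- The value at `τ` of the cut-off `f_η((a - δ)_+)`. -/
noncomputable def cutValue (a : A) (τ : WeakDual ℂ A) (η δ : ℝ) : ℝ :=
  (τ (cfc (fun t => fcut η (t - δ)) a)).re

theorem continuous_fcut_sub (η δ : ℝ) : Continuous fun t => fcut η (t - δ) :=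
  (continuous_fcut η).comp (by fun_prop)

theorem cutValue_mono {a : A} {τ : WeakDual ℂ A} (hτ : τ ∈ tracialStates A) {η η' δ δ' : ℝ}
    (h : ∀ t, fcut η (t - δ) ≤ fcut η' (t - δ')) : cutValue a τ η δ ≤ cutValue a τ η' δ' :=
  re_apply_mono_of_mem_tracialStates hτ <| cfc_mono (fun t _ => h t)
    (continuous_fcut_sub _ _).continuousOn (continuous_fcut_sub _ _).continuousOn

theorem cutValue_le_one {a : A} {τ : WeakDual ℂ A}
    (hτ : τ ∈ tracialStates A) (η δ : ℝ) : cutValue a τ η δ ≤ 1 := by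
  have := re_apply_mono_of_mem_tracialStates hτ
    (cfc_le_one (fun t => fcut η (t - δ)) a fun t _ => fcut_le_one _ _)
  rwa [hτ.1] at this

theorem continuous_cutValue (a : A) (η δ : ℝ) :
    Continuous fun τ : WeakDual ℂ A => cutValue a τ η δ :=
  Complex.continuous_re.comp (WeakDual.eval_continuous _)

/-- The rank of `(a - δ)_+` at `τ`. -/
noncomputable def rankAbove (a : A) (τ : WeakDual ℂ A) (δ : ℝ) : ℝ :=
  sSup {r : ℝ | ∃ η : ℝ, 0 < η ∧ r = cutValue a τ η δ}

theorem cutValue_le_rankAbove {a : A} {τ : WeakDual ℂ A}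
    (hτ : τ ∈ tracialStates A) {η : ℝ} (hη : 0 < η) (δ : ℝ) :
    cutValue a τ η δ ≤ rankAbove a τ δ :=
  le_csSup ⟨1, by rintro _ ⟨η, -, rfl⟩; exact cutValue_le_one hτ _ _⟩ ⟨η, hη, rfl⟩

theorem rankAbove_le {a : A} {τ : WeakDual ℂ A} {δ c : ℝ}
    (h : ∀ η, 0 < η → cutValue a τ η δ ≤ c) : rankAbove a τ δ ≤ c :=
  csSup_le ⟨_, 1, one_pos, rfl⟩ (by rintro _ ⟨η, hη, rfl⟩; exact h η hη)

theorem rankAbove_antitone {a : A} {τ : WeakDual ℂ A}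
    (hτ : τ ∈ tracialStates A) : Antitone (rankAbove a τ) := fun _ δ' h =>
  rankAbove_le fun η hη => (cutValue_mono hτ fun _ => fcut_mono hη (by linarith)).trans
    (cutValue_le_rankAbove hτ hη _)

theorem rankAbove_le_cutValue {a : A} {τ : WeakDual ℂ A} (hτ : τ ∈ tracialStates A) {η : ℝ}
    (hη : 0 < η) (δ : ℝ) : rankAbove a τ δ ≤ cutValue a τ η (δ - η) := by
  refine rankAbove_le fun η' hη' => cutValue_mono hτ fun t => ?_
  rcases le_total t δ with h | h
  · rw [fcut_of_nonpos hη' (by linarith)]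
    exact fcut_nonneg _ _
  · rw [fcut_of_ge hη (by linarith)]
    exact fcut_le_one _ _

/-- `cutGap a η δ` dominates the spectral projection of `a` at `{δ}`, and decreases to it as `η`
tends to `0`. -/
noncomputable def cutGap (a : A) (η δ : ℝ) : A :=
  cfc (fun t => fcut η (t - (δ - η))) a - cfc (fun t => fcut η (t - δ)) a

theorem re_apply_cutGap (a : A) (τ : WeakDual ℂ A) (η δ : ℝ) :
    (τ (cutGap a η δ)).re = cutValue a τ η (δ - η) - cutValue a τ η δ := by
  simp [cutGap, cutValue]

theorem re_apply_cutGap_mono {a : A} {τ : WeakDual ℂ A} (hτ : τ ∈ tracialStates A) {η η' : ℝ}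
    (hη : 0 < η) (h : η ≤ η') (δ : ℝ) :
    (τ (cutGap a η δ)).re ≤ (τ (cutGap a η' δ)).re := by
  rw [re_apply_cutGap, re_apply_cutGap]
  have h1 : cutValue a τ η' δ ≤ cutValue a τ η δ := cutValue_mono hτ fun t => fcut_anti hη h _
  have h2 : cutValue a τ η (δ - η) ≤ cutValue a τ η' (δ - η') := by
    refine cutValue_mono hτ fun t => ?_
    have hη' := hη.trans_le h
    unfold fcut
    have h1 : ∀ e : ℝ, 0 < e → (t - (δ - e) - e / 2) / (e / 2) = 1 + 2 * (t - δ) / e :=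
      fun e he => by field_simp; ring
    rw [h1 _ hη, h1 _ hη']
    rcases le_total t δ with ht | ht
    · have : 2 * (t - δ) / η ≤ 2 * (t - δ) / η' := by
        rw [div_le_div_iff₀ hη hη']
        nlinarith
      gcongr
    · have : 0 ≤ 2 * (t - δ) / η' := by
        have := sub_nonneg.2 ht
        positivity
      rw [min_eq_left (le_max_of_le_right (by linarith : (1 : ℝ) ≤ 1 + 2 * (t - δ) / η'))]
      exact min_le_left _ _
  linarith

theorem re_apply_cutGap_nonneg {a : A} {τ : WeakDual ℂ A} (hτ : τ ∈ tracialStates A) {η : ℝ}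
    (hη : 0 < η) (δ : ℝ) : 0 ≤ (τ (cutGap a η δ)).re := by
  rw [re_apply_cutGap, sub_nonneg]
  exact cutValue_mono hτ fun t => fcut_mono hη (by linarith)

theorem exists_re_apply_cutGap_lt {a : A} {τ : WeakDual ℂ A}
    (hτ : τ ∈ tracialStates A) {δ : ℝ} (hδ : ContinuousAt (rankAbove a τ) δ) {κ : ℝ}
    (hκ : 0 < κ) : ∃ η > 0, (τ (cutGap a η δ)).re < κ := by
  obtain ⟨_, ⟨η₁, hη₁, rfl⟩, hlt⟩ := exists_lt_of_lt_csSup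
    (show {r : ℝ | ∃ η : ℝ, 0 < η ∧ r = cutValue a τ η δ}.Nonempty from ⟨_, 1, one_pos, rfl⟩)
    (show rankAbove a τ δ - κ / 2 < rankAbove a τ δ by linarith)
  obtain ⟨ρ, hρ, hball⟩ := Metric.continuousAt_iff.1 hδ (κ / 2) (by linarith)
  have hη : 0 < min η₁ (ρ / 2) := by positivity
  refine ⟨min η₁ (ρ / 2), hη, ?_⟩
  set η := min η₁ (ρ / 2)
  have h1 : cutValue a τ η₁ δ ≤ cutValue a τ η δ :=
    cutValue_mono hτ fun t => fcut_anti hη (min_le_left _ _) _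
  have h2 := cutValue_le_rankAbove (a := a) hτ hη (δ - η)
  have h3 := hball (x := δ - η) (by
    rw [Real.dist_eq, sub_sub_cancel_left, abs_neg, abs_of_pos hη]
    linarith [min_le_right η₁ (ρ / 2)])
  rw [Real.dist_eq] at h3
  have h4 := (abs_lt.1 h3).2
  rw [re_apply_cutGap]
  linarith

theorem exists_re_apply_cutGap_lt_of_forall_extremePoints {a : A} {δ : ℝ}
    (hδ : ∀ τ ∈ (tracialStates A).extremePoints ℝ, ContinuousAt (rankAbove a τ) δ)
    {τ : WeakDual ℂ A} (hτ : τ ∈ tracialStates A) {κ : ℝ} (hκ : 0 < κ) :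
    ∃ η > 0, (τ (cutGap a η δ)).re < κ := by
  let p : ℕ → WeakDual ℂ A →L[ℝ] ℝ := fun n =>
    { toFun := fun τ => (τ (cutGap a (1 / ((n : ℝ) + 1)) δ)).re
      map_add' := fun _ _ => rfl
      map_smul' := fun c σ => by
        change ((c • (σ (cutGap a (1 / ((n : ℝ) + 1)) δ)) : ℂ)).re = _
        simp
      cont := Complex.continuous_re.comp (WeakDual.eval_continuous _) }
  have : LocallyConvexSpace ℝ (WeakDual ℂ A) :=
    .induced ({ toFun := DFunLike.coe, map_add' := fun _ _ => rfl, map_smul' := fun _ _ => rfl } :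
      WeakDual ℂ A →ₗ[ℝ] A → ℂ)
  have hpos : ∀ n : ℕ, (0 : ℝ) < 1 / ((n : ℝ) + 1) := fun n => Nat.one_div_pos_of_nat
  have hanti : ∀ σ ∈ tracialStates A, Antitone fun n => p n σ := fun σ hσ m n hmn =>
    re_apply_cutGap_mono hσ (hpos n) (Nat.one_div_le_one_div hmn) δ
  have hnn : ∀ σ ∈ tracialStates A, ∀ n, 0 ≤ p n σ := fun σ hσ n =>
    re_apply_cutGap_nonneg hσ (hpos n) δ
  have hlim := tendsto_zero_of_tendsto_zero_extremePoints isCompact_tracialStates p hanti hnn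
    (fun σ hσ => by
      rw [Metric.tendsto_atTop]
      intro κ hκ
      obtain ⟨η, hη, hlt⟩ := exists_re_apply_cutGap_lt hσ.1 (hδ σ hσ) hκ
      obtain ⟨N, hN⟩ := exists_nat_one_div_lt hη
      refine ⟨N, fun n hn => ?_⟩
      rw [Real.dist_0_eq_abs, abs_of_nonneg (hnn σ hσ.1 n)]
      exact (hanti σ hσ.1 hn).trans_lt
        ((re_apply_cutGap_mono hσ.1 (hpos N) hN.le δ).trans_lt hlt)) τ hτ
  obtain ⟨n, hn⟩ := (hlim.eventually_lt_const hκ).exists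
  exact ⟨_, hpos n, hn⟩

theorem continuousOn_rankAbove {a : A} {δ : ℝ}
    (hδ : ∀ τ ∈ (tracialStates A).extremePoints ℝ, ContinuousAt (rankAbove a τ) δ) :
    ContinuousOn (fun τ => rankAbove a τ δ) (tracialStates A) := by
  intro τ hτ
  rw [ContinuousWithinAt, Metric.tendsto_nhds]
  intro κ hκ
  obtain ⟨η, hη, hlt⟩ := exists_re_apply_cutGap_lt_of_forall_extremePoints hδ hτ
    (show 0 < κ / 2 by linarith)
  rw [re_apply_cutGap] at hlt
  have hev (δ' : ℝ) : ∀ᶠ σ in 𝓝[tracialStates A] τ,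
      dist (cutValue a σ η δ') (cutValue a τ η δ') < κ / 2 :=
    Metric.tendsto_nhds.1 ((continuous_cutValue a η δ').continuousAt.continuousWithinAt) _
      (by linarith)
  filter_upwards [hev δ, hev (δ - η), self_mem_nhdsWithin] with σ h1 h2 hσ
  rw [Real.dist_eq, abs_lt] at *
  have := cutValue_le_rankAbove (a := a) hτ hη δ
  have := cutValue_le_rankAbove (a := a) hσ hη δ
  have := rankAbove_le_cutValue (a := a) hτ hη δ
  have := rankAbove_le_cutValue (a := a) hσ hη δ
  constructor <;> linarith [h1.1, h1.2, h2.1, h2.2]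

theorem dtauW_cfc_max_sub (a : A) (ha : IsSelfAdjoint a) (τ : WeakDual ℂ A) (δ : ℝ) :
    dtauW τ (cfc (fun t => max (t - δ) 0) a) = rankAbove a τ δ := by
  have h : ∀ η : ℝ, 0 < η → cfc (fcut η) (cfc (fun t => max (t - δ) 0) a) =
      cfc (fun t => fcut η (t - δ)) a := fun η hη => by
    rw [← cfc_comp' (fcut η) (fun t => max (t - δ) 0) a (continuous_fcut η).continuousOn
      (by fun_prop)]
    congr 1
    ext t
    rcases le_total (t - δ) 0 with ht | ht
    · rw [max_eq_right ht, fcut_of_nonpos hη le_rfl, fcut_of_nonpos hη ht]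
    · rw [max_eq_left ht]
  unfold dtauW rankAbove cutValue
  congr 1
  ext r
  exact exists_congr fun η => and_congr_right fun hη => by rw [h η hη]

theorem cfc_max_sub_mem_herSet {a : A} (ha : IsSelfAdjoint a) {δ : ℝ} (hδ : 0 < δ) :
    cfc (fun t => max (t - δ) 0) a ∈ herSet a := by
  have hden (t : ℝ) : max t δ ≠ 0 := (hδ.trans_le (le_max_right t δ)).ne'
  have hcont : Continuous fun t : ℝ => max (t - δ) 0 / max t δ ^ 2 :=
    Continuous.div (by fun_prop) (by fun_prop) fun t => pow_ne_zero 2 (hden t)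
  refine subset_closure ⟨cfc (fun t => max (t - δ) 0 / max t δ ^ 2) a, ?_⟩
  have hmul : cfc (fun t => t * (max (t - δ) 0 / max t δ ^ 2) * t) a =
      a * cfc (fun t => max (t - δ) 0 / max t δ ^ 2) a * a := by
    rw [cfc_mul (fun t => t * (max (t - δ) 0 / max t δ ^ 2)) (fun t => t) a
        (by fun_prop (disch := simp [hden])) (by fun_prop),
      cfc_mul (fun t => t) _ a (by fun_prop) hcont.continuousOn, cfc_id' ℝ a]
  rw [← hmul]
  congr 1
  ext t
  rcases le_total t δ with ht | ht
  · simp [max_eq_right (sub_nonpos.2 ht)]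
  · rw [max_eq_left ht]
    have := (hδ.trans_le ht).ne'
    field_simp

theorem norm_sub_cfc_max_sub_le {a : A} (ha : 0 ≤ a) {δ : ℝ} (hδ : 0 < δ) :
    ‖a - cfc (fun t => max (t - δ) 0) a‖ ≤ δ := by
  nth_rw 1 [← cfc_id' ℝ a]
  rw [← cfc_sub _ _ a (by fun_prop) (by fun_prop)]
  refine norm_cfc_le hδ.le fun t ht => ?_
  have := spectrum_nonneg_of_nonneg ha ht
  rw [Real.norm_eq_abs, abs_le]
  rcases max_cases (t - δ) 0 with h | h <;> constructor <;> linarith [h.1, h.2]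

/-- Theorem 5.8 of the paper (unital case).  If the extreme boundary of the
tracial state space `T(A)` of a unital C*-algebra `A` is countable, then every positive
contraction `a` can be approximated in norm by positive elements `b` of the hereditary
subalgebra `Her(a)` whose rank function `τ ↦ d_τ(b)` is continuous on `T(A)`
(with the weak-* topology). -/
theorem stmt6 (hT : (Set.extremePoints ℝ (tracialStates A)).Countable)
    (a : A) (ha : 0 ≤ a) (ha1 : a ≤ 1) :
    ∀ ε > 0, ∃ b ∈ herSet a, 0 ≤ b ∧ ‖a - b‖ < ε ∧
      ContinuousOn (fun τ : WeakDual ℂ A => dtauW τ b) (tracialStates A) := by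
  intro ε hε
  have hsa : IsSelfAdjoint a := .of_nonneg ha
  have hcount : (⋃ τ ∈ (tracialStates A).extremePoints ℝ,
      {δ | ¬ContinuousAt (rankAbove a τ) δ}).Countable :=
    hT.biUnion fun τ hτ => (rankAbove_antitone hτ.1).countable_not_continuousAt
  obtain ⟨δ, hδ, hmem⟩ := (hcount.dense_compl ℝ).exists_between hε
  have hcont : ∀ τ ∈ (tracialStates A).extremePoints ℝ, ContinuousAt (rankAbove a τ) δ := by
    simpa using hδ
  refine ⟨cfc (fun t => max (t - δ) 0) a, cfc_max_sub_mem_herSet hsa hmem.1,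
    cfc_nonneg fun t _ => le_max_right _ _,
    (norm_sub_cfc_max_sub_le ha hmem.1).trans_lt hmem.2, ?_⟩
  simpa only [dtauW_cfc_max_sub a hsa] using continuousOn_rankAbove hcont
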